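/- arXiv:2210.11659 — 2 statements merged into one kernel-verified Lean document; each statement's English description precedes it below -/
import Mathlib

section
/- Let k be a field of characteristic 0. The eight points P1 = (0:1:1), P2 = (0:319:−920), P3 = (1:0:1), P4 = (799:0:610), P5 = (1:1:1), P6 = (1:1:−1), P7 = (31:1:123), P8 = (31:1:11) of ℙ²(k) are in general position. -/
open MvPolynomial

noncomputable section

variable {k : Type*} [Field k]

/-- The projective plane over `k`. -/
abbrev P2 (k : Type*) [Field k] := Projectivization k (Fin 3 → k)

lemma ne_zero_of_coord {k : Type*} [Field k] {x y z : k} (i : Fin 3)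
    (h : ![x, y, z] i ≠ 0) : ![x, y, z] ≠ 0 :=
  fun h0 => h (by rw [h0]; rfl)

/-- The point of the projective plane with homogeneous coordinates `(x : y : z)`. -/
def pt (x y z : k) (h : ![x, y, z] ≠ 0) : P2 k := Projectivization.mk k ![x, y, z] h

/-- A homogeneous form vanishes at a projective point. -/
def VanishesAt (F : MvPolynomial (Fin 3) k) (P : P2 k) : Prop :=
  eval P.rep F = 0

/-- A form is singular at a projective point: all three partial derivatives vanish there. -/
def SingularAt (F : MvPolynomial (Fin 3) k) (P : P2 k) : Prop :=
  ∀ i : Fin 3, eval P.rep (pderiv i F) = 0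

/-- Eight points of the projective plane are in general position. -/
def GeneralPosition (p : Fin 8 → P2 k) : Prop :=
  Function.Injective p ∧
  (∀ i j l : Fin 8, i ≠ j → i ≠ l → j ≠ l →
    LinearIndependent k ![(p i).rep, (p j).rep, (p l).rep]) ∧
  (¬ ∃ F : MvPolynomial (Fin 3) k, F ≠ 0 ∧ F.IsHomogeneous 2 ∧
    ∃ s : Finset (Fin 8), s.card = 6 ∧ ∀ i ∈ s, VanishesAt F (p i)) ∧
  (¬ ∃ F : MvPolynomial (Fin 3) k, F ≠ 0 ∧ F.IsHomogeneous 3 ∧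
    (∀ i, VanishesAt F (p i)) ∧ ∃ i, SingularAt F (p i))

/-- A form of degree `n` in `x, y, z` is the sum of its monomials of degree `n`. -/
lemma isHomogeneous_eq_sum {F : MvPolynomial (Fin 3) k} {n : ℕ} (hF : F.IsHomogeneous n) :
    F = ∑ t ∈ Finset.Nat.antidiagonalTuple 3 n,
      C (coeff (Finsupp.equivFunOnFinite.symm t) F) * (X 0 ^ t 0 * X 1 ^ t 1 * X 2 ^ t 2) := by
  have hsub : F.support ⊆ (Finset.Nat.antidiagonalTuple 3 n).map
      Finsupp.equivFunOnFinite.symm.toEmbedding := by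
    intro d hd
    refine Finset.mem_map.2 ⟨d, ?_, by ext; simp⟩
    rw [Finset.Nat.mem_antidiagonalTuple]
    exact (Finsupp.degree_eq_sum d).symm.trans (hF.degree_eq_sum_deg_support hd).symm
  conv_lhs => rw [F.as_sum, Finset.sum_subset hsub (by simp +contextual), Finset.sum_map]
  refine Finset.sum_congr rfl fun t _ => ?_
  simp [monomial_eq, Finsupp.prod_fintype, Fin.prod_univ_three]

lemma exists_quadratic_eq {F : MvPolynomial (Fin 3) k} (hF : F.IsHomogeneous 2) :
    ∃ c : Fin 6 → k, F = C (c 0) * X 0 ^ 2 + C (c 1) * (X 0 * X 1) + C (c 2) * X 1 ^ 2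
      + C (c 3) * (X 0 * X 2) + C (c 4) * (X 1 * X 2) + C (c 5) * X 2 ^ 2 := by
  have hT : Finset.Nat.antidiagonalTuple 3 2 =
      {![2, 0, 0], ![1, 1, 0], ![0, 2, 0], ![1, 0, 1], ![0, 1, 1], ![0, 0, 2]} := by decide
  have h := isHomogeneous_eq_sum hF
  let a (t : Fin 3 → ℕ) := coeff (Finsupp.equivFunOnFinite.symm t) F
  refine ⟨![a ![2, 0, 0], a ![1, 1, 0], a ![0, 2, 0], a ![1, 0, 1], a ![0, 1, 1],
    a ![0, 0, 2]], h.trans ?_⟩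
  rw [hT]
  simp [a]
  ring

lemma exists_cubic_eq {F : MvPolynomial (Fin 3) k} (hF : F.IsHomogeneous 3) :
    ∃ c : Fin 10 → k, F = C (c 0) * X 0 ^ 3 + C (c 1) * (X 0 ^ 2 * X 1)
      + C (c 2) * (X 0 * X 1 ^ 2) + C (c 3) * X 1 ^ 3 + C (c 4) * (X 0 ^ 2 * X 2)
      + C (c 5) * (X 0 * X 1 * X 2) + C (c 6) * (X 1 ^ 2 * X 2) + C (c 7) * (X 0 * X 2 ^ 2)
      + C (c 8) * (X 1 * X 2 ^ 2) + C (c 9) * X 2 ^ 3 := by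
  have hT : Finset.Nat.antidiagonalTuple 3 3 =
      {![3, 0, 0], ![2, 1, 0], ![1, 2, 0], ![0, 3, 0], ![2, 0, 1], ![1, 1, 1], ![0, 2, 1],
        ![1, 0, 2], ![0, 1, 2], ![0, 0, 3]} := by decide
  have h := isHomogeneous_eq_sum hF
  let a (t : Fin 3 → ℕ) := coeff (Finsupp.equivFunOnFinite.symm t) F
  refine ⟨![a ![3, 0, 0], a ![2, 1, 0], a ![1, 2, 0], a ![0, 3, 0], a ![2, 0, 1],
    a ![1, 1, 1], a ![0, 2, 1], a ![1, 0, 2], a ![0, 1, 2], a ![0, 0, 3]], h.trans ?_⟩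
  rw [hT]
  simp [a]
  ring

lemma eval_smul_of_isHomogeneous {F : MvPolynomial (Fin 3) k} {n : ℕ} (hF : F.IsHomogeneous n)
    (a : k) (v : Fin 3 → k) : eval (a • v) F = a ^ n * eval v F := by
  rw [isHomogeneous_eq_sum hF, map_sum, map_sum, Finset.mul_sum]
  refine Finset.sum_congr rfl fun t ht => ?_
  rw [← (Finset.Nat.mem_antidiagonalTuple.1 ht), Fin.sum_univ_three]
  simp
  ring

/-- `v` is a vector of homogeneous coordinates of `P`. -/
def HasCoords (P : P2 k) (v : Fin 3 → k) : Prop :=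
  ∃ a : kˣ, P.rep = a • v

lemma hasCoords_pt (x y z : k) (h : ![x, y, z] ≠ 0) : HasCoords (pt x y z h) ![x, y, z] :=
  (Projectivization.exists_smul_eq_mk_rep k _ h).imp fun _ => Eq.symm

lemma HasCoords.eval_rep_eq_zero {P : P2 k} {v : Fin 3 → k} (hP : HasCoords P v)
    {F : MvPolynomial (Fin 3) k} {n : ℕ} (hF : F.IsHomogeneous n) :
    eval P.rep F = 0 ↔ eval v F = 0 := by
  obtain ⟨a, ha⟩ := hP
  rw [ha, Units.smul_def, eval_smul_of_isHomogeneous hF]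
  simp

lemma linearIndependent_rep_of_det_ne_zero {P Q R : P2 k} {u v w : Fin 3 → k}
    (hP : HasCoords P u) (hQ : HasCoords Q v) (hR : HasCoords R w)
    (h : (Matrix.of ![u, v, w]).det ≠ 0) : LinearIndependent k ![P.rep, Q.rep, R.rep] := by
  obtain ⟨a, ha⟩ := hP
  obtain ⟨b, hb⟩ := hQ
  obtain ⟨c, hc⟩ := hR
  have hli : LinearIndependent k ![u, v, w] :=
    Matrix.linearIndependent_rows_of_det_ne_zero h
  have he : ![P.rep, Q.rep, R.rep] = ![a, b, c] • ![u, v, w] := by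
    ext i
    fin_cases i <;> simp [ha, hb, hc]
  rw [he]
  exact hli.units_smul _

/-- Integral homogeneous coordinates of the eight points. -/
def exampleCoords : Fin 8 → Fin 3 → ℤ :=
  ![![0, 1, 1], ![0, 319, -920], ![1, 0, 1], ![799, 0, 610],
    ![1, 1, 1], ![1, 1, -1], ![31, 1, 123], ![31, 1, 11]]

lemma det_exampleCoords_ne_zero : ∀ i j l : Fin 8, i ≠ j → i ≠ l → j ≠ l →
    (Matrix.of ![exampleCoords i, exampleCoords j, exampleCoords l]).det ≠ 0 := by
  simp only [Matrix.det_fin_three]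
  decide +kernel

section CharZero

variable [CharZero k]

lemma quadratic_eq_zero_of_eval_eq_zero {F : MvPolynomial (Fin 3) k} (hF : F.IsHomogeneous 2)
    {s : Finset (Fin 8)} (hs : s.card = 6)
    (h : ∀ m ∈ s, eval (fun i => (exampleCoords m i : k)) F = 0) : F = 0 := by
  obtain ⟨c, rfl⟩ := exists_quadratic_eq hF
  clear hF
  -- The two linear relations among the values of quadratic forms at the eight points.
  let q (m : Fin 8) := eval (fun i => (exampleCoords m i : k)) (C (c 0) * X 0 ^ 2
    + C (c 1) * (X 0 * X 1) + C (c 2) * X 1 ^ 2 + C (c 3) * (X 0 * X 2)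
    + C (c 4) * (X 1 * X 2) + C (c 5) * X 2 ^ 2)
  let w₁ : Fin 8 → ℤ :=
    ![223801686, -2196, 3530201516, -5546, -435000510, 434654829, 11151, 0]
  let w₂ : Fin 8 → ℤ :=
    ![19171890, -180, 350154380, -590, -36597582, 35714175, 0, 28497]
  have hw₁ : ∑ m, (w₁ m : k) * q m = 0 := by
    simp [Fin.sum_univ_eight, w₁, q, exampleCoords]
    ring
  have hw₂ : ∑ m, (w₂ m : k) * q m = 0 := by
    simp [Fin.sum_univ_eight, w₂, q, exampleCoords]
    ring
  have hminor : ∀ i j, i ≠ j → w₁ i * w₂ j - w₁ j * w₂ i ≠ 0 := by decide +kernel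
  obtain ⟨i, j, hij, hsc⟩ : ∃ i j, i ≠ j ∧ sᶜ = {i, j} :=
    Finset.card_eq_two.1 (by rw [Finset.card_compl, hs]; rfl)
  have hq : ∀ m, m ≠ i → m ≠ j → q m = 0 := fun m hi hj => h m <| by
    have : m ∉ sᶜ := by simp [hsc, hi, hj]
    simpa using this
  have hsum (w : Fin 8 → ℤ) : ∑ m, (w m : k) * q m = w i * q i + w j * q j :=
    Finset.sum_eq_add i j hij (fun m _ hm => by rw [hq m hm.1 hm.2, mul_zero])
      (by simp) (by simp)
  rw [hsum] at hw₁ hw₂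
  have hd : (w₁ i : k) * w₂ j - w₁ j * w₂ i ≠ 0 := by exact_mod_cast hminor i j hij
  have hqi : q i = 0 := by
    refine (mul_eq_zero.1 ?_).resolve_left hd
    linear_combination (w₂ j : k) * hw₁ - (w₁ j : k) * hw₂
  have hqj : q j = 0 := by
    refine (mul_eq_zero.1 ?_).resolve_left hd
    linear_combination (w₁ i : k) * hw₂ - (w₂ i : k) * hw₁
  have hall : ∀ m, q m = 0 := fun m => by
    by_cases hi : m = i
    · rwa [hi]
    by_cases hj : m = j
    · rwa [hj]
    exact hq m hi hj
  simp [Fin.forall_fin_succ, exampleCoords, q] at hall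
  obtain ⟨h0, h1, h2, h3, h4, h5⟩ :
      c 0 = 0 ∧ c 1 = 0 ∧ c 2 = 0 ∧ c 3 = 0 ∧ c 4 = 0 ∧ c 5 = 0 := by grind
  simp [h0, h1, h2, h3, h4, h5]

lemma cubic_eq_zero_of_singular {F : MvPolynomial (Fin 3) k} (hF : F.IsHomogeneous 3)
    (h : ∀ m, eval (fun i => (exampleCoords m i : k)) F = 0) (m : Fin 8)
    (hm : ∀ l, eval (fun i => (exampleCoords m i : k)) (pderiv l F) = 0) : F = 0 := by
  obtain ⟨c, rfl⟩ := exists_cubic_eq hF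
  clear hF
  simp only [Fin.forall_fin_succ, exampleCoords] at h hm
  simp at h
  obtain ⟨h0, h1, h2, h3, h4, h5, h6, h7, h8, h9⟩ :
      c 0 = 0 ∧ c 1 = 0 ∧ c 2 = 0 ∧ c 3 = 0 ∧ c 4 = 0 ∧ c 5 = 0 ∧ c 6 = 0 ∧ c 7 = 0 ∧
        c 8 = 0 ∧ c 9 = 0 := by
    fin_cases m <;> simp [pderiv_X, Pi.single_apply] at hm <;> grind
  simp [h0, h1, h2, h3, h4, h5, h6, h7, h8, h9]

end CharZero

theorem example_points_general_position_charZero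
    {k : Type*} [Field k] [CharZero k] :
    GeneralPosition
    ![pt (0 : k) 1 1 (ne_zero_of_coord 1 (by norm_num)),
      pt (0 : k) 319 (-920) (ne_zero_of_coord 1 (by norm_num)),
      pt (1 : k) 0 1 (ne_zero_of_coord 0 (by norm_num)),
      pt (799 : k) 0 610 (ne_zero_of_coord 0 (by norm_num)),
      pt (1 : k) 1 1 (ne_zero_of_coord 0 (by norm_num)),
      pt (1 : k) 1 (-1) (ne_zero_of_coord 0 (by norm_num)),
      pt (31 : k) 1 123 (ne_zero_of_coord 1 (by norm_num)),
      pt (31 : k) 1 11 (ne_zero_of_coord 1 (by norm_num))] := by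
  set p : Fin 8 → P2 k := _
  change GeneralPosition p
  have hp (m : Fin 8) : HasCoords (p m) (fun i => (exampleCoords m i : k)) := by
    have key (x y z : k) (h : ![x, y, z] ≠ 0) (v : Fin 3 → k) (hv : v = ![x, y, z]) :
        HasCoords (pt x y z h) v := hv ▸ hasCoords_pt x y z h
    fin_cases m <;> refine key _ _ _ _ _ ?_ <;> ext i <;> fin_cases i <;> simp [exampleCoords]
  have hli (i j l : Fin 8) (hij : i ≠ j) (hil : i ≠ l) (hjl : j ≠ l) :
      LinearIndependent k ![(p i).rep, (p j).rep, (p l).rep] := by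
    refine linearIndependent_rep_of_det_ne_zero (hp i) (hp j) (hp l) ?_
    have h := det_exampleCoords_ne_zero i j l hij hil hjl
    rw [Matrix.det_fin_three] at h ⊢
    simp only [Matrix.of_apply, Matrix.cons_val] at h ⊢
    exact_mod_cast h
  refine ⟨fun i j h => ?_, hli, ?_, ?_⟩
  · by_contra hij
    obtain ⟨l, hil, hjl⟩ : ∃ l, i ≠ l ∧ j ≠ l :=
      (by decide : ∀ i j : Fin 8, ∃ l, i ≠ l ∧ j ≠ l) i j
    have h01 := (hli i j l hij hil hjl).injective.ne (show (0 : Fin 3) ≠ 1 by decide)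
    exact h01 (by simp [h])
  · rintro ⟨F, hF0, hF, s, hs, h⟩
    exact hF0 (quadratic_eq_zero_of_eval_eq_zero hF hs fun m hm =>
      ((hp m).eval_rep_eq_zero hF).1 (h m hm))
  · rintro ⟨F, hF0, hF, h, m, hm⟩
    exact hF0 (cubic_eq_zero_of_singular hF (fun m => ((hp m).eval_rep_eq_zero hF).1 (h m)) m
      fun l => ((hp m).eval_rep_eq_zero hF.pderiv).1 (hm l))

end
end

section
/- Every homogeneous cubic form F ∈ ℚ[x,y,z] that vanishes at the eight points (0:1:1), (0:14:13), (1:0:1), (21:0:13), (1:1:1), (6:6:−1), (−2:2:1), (−3:3:−1) of ℙ²(ℚ) also vanishes at the point (27:68:109). -/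
open MvPolynomial

theorem eight_points_monomial_relation (a b c : ℕ) (h : a + b + c = 3) :
    (27 : ℚ) ^ a * 68 ^ b * 109 ^ c =
      3680160 * (0 ^ a * 1 ^ b * 1 ^ c) - 17425 / 14 * (0 ^ a * 14 ^ b * 13 ^ c)
      + 784125 / 2 * (1 ^ a * 0 ^ b * 1 ^ c) - 2255 / 42 * (21 ^ a * 0 ^ b * 13 ^ c)
      + 673200 / 7 * (1 ^ a * 1 ^ b * 1 ^ c) - 3485 / 84 * (6 ^ a * 6 ^ b * (-1) ^ c)
      - 69003 / 4 * ((-2) ^ a * 2 ^ b * 1 ^ c) + 11152 / 3 * ((-3) ^ a * 3 ^ b * (-1) ^ c) := by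
  have ha : a ≤ 3 := by omega
  have hb : b ≤ 3 := by omega
  obtain rfl : c = 3 - a - b := by omega
  interval_cases a <;> interval_cases b <;> first | omega | norm_num

/-- Every homogeneous cubic form vanishing at the eight listed points of `ℙ²(ℚ)`
also vanishes at the point `(27 : 68 : 109)`. -/
theorem cubics_through_eight_points_pass_through_base_point
    (F : MvPolynomial (Fin 3) ℚ) (hF : F.IsHomogeneous 3)
    (h1 : eval ![(0 : ℚ), 1, 1] F = 0)
    (h2 : eval ![(0 : ℚ), 14, 13] F = 0)
    (h3 : eval ![(1 : ℚ), 0, 1] F = 0)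
    (h4 : eval ![(21 : ℚ), 0, 13] F = 0)
    (h5 : eval ![(1 : ℚ), 1, 1] F = 0)
    (h6 : eval ![(6 : ℚ), 6, -1] F = 0)
    (h7 : eval ![(-2 : ℚ), 2, 1] F = 0)
    (h8 : eval ![(-3 : ℚ), 3, -1] F = 0) :
    eval ![(27 : ℚ), 68, 109] F = 0 := by
  have key : eval ![(27 : ℚ), 68, 109] F =
      3680160 * eval ![(0 : ℚ), 1, 1] F - 17425 / 14 * eval ![(0 : ℚ), 14, 13] F
      + 784125 / 2 * eval ![(1 : ℚ), 0, 1] F - 2255 / 42 * eval ![(21 : ℚ), 0, 13] F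
      + 673200 / 7 * eval ![(1 : ℚ), 1, 1] F - 3485 / 84 * eval ![(6 : ℚ), 6, -1] F
      - 69003 / 4 * eval ![(-2 : ℚ), 2, 1] F + 11152 / 3 * eval ![(-3 : ℚ), 3, -1] F := by
    simp only [eval_eq', Finset.mul_sum, ← Finset.sum_add_distrib, ← Finset.sum_sub_distrib]
    refine Finset.sum_congr rfl fun d hd => ?_
    have hdeg : d 0 + d 1 + d 2 = 3 := by
      rw [← Fin.sum_univ_three, ← Finsupp.degree_eq_sum]
      exact (hF.degree_eq_sum_deg_support hd).symm
    simp only [Fin.prod_univ_three, Matrix.cons_val]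
    linear_combination coeff d F * eight_points_monomial_relation (d 0) (d 1) (d 2) hdeg
  rw [key, h1, h2, h3, h4, h5, h6, h7, h8]
  norm_num
end
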